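/- arXiv:1904.13107 — 3 statements merged into one kernel-verified Lean document; each statement's English description precedes it below -/
import Mathlib

section
/- Fix a partition of {1,…,N} into K nonempty blocks with sampling operators C^(k) ∈ ℝ^{N×N_k}, orthonormal bases u_1^(k), …, u_{N_k}^(k) of ℝ^{N_k} padded by zeros up to N_max = max_k N_k, up-sampled vectors ū_l^(k) = C^(k) u_l^(k), and pooling operators Θ_l = [ū_l^(1), …, ū_l^(K)] ∈ ℝ^{N×K}. Then every graph signal x ∈ ℝ^N is perfectly reconstructed from its pooled signals x_l = Θ_lᵀ x: x = Σ_{l=1}^{N_max} Θ_l x_l, i.e. Σ_{l=1}^{N_max} Θ_l Θ_lᵀ x = x. -/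
open Matrix BigOperators

/-- (Perfect reconstruction) For a partition with sampling operators
`C^(k)`, orthonormal bases padded by zeros up to `N_max`, and pooling operators
`Θ_l = [ū_l^(1), …, ū_l^(K)]`, every graph signal `x` is perfectly reconstructed
from its pooled signals `x_l = Θ_lᵀ x`:  `x = Σ_{l=1}^{N_max} Θ_l x_l`. -/
theorem eigenpooling_perfect_reconstruction {N K : ℕ} (hK : 0 < K)
    (Nk : Fin K → ℕ) (hNk : ∀ k, 0 < Nk k)
    (Γ : (k : Fin K) → Fin (Nk k) → Fin N)
    (hinj : ∀ k, Function.Injective (Γ k))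
    (hpart : ∀ i : Fin N, ∃! p : Σ k : Fin K, Fin (Nk k), Γ p.1 p.2 = i)
    (C : (k : Fin K) → Matrix (Fin N) (Fin (Nk k)) ℝ)
    (hC : ∀ k i j, C k i j = if Γ k j = i then 1 else 0)
    (Nmax : ℕ) (hNmax : Nmax = Finset.univ.sup Nk)
    (u : (k : Fin K) → Fin Nmax → (Fin (Nk k) → ℝ))
    (horth : ∀ k, ∀ l l' : Fin Nmax, (l : ℕ) < Nk k → (l' : ℕ) < Nk k →
      u k l ⬝ᵥ u k l' = if l = l' then 1 else 0)
    (hpad : ∀ k, ∀ l : Fin Nmax, Nk k ≤ (l : ℕ) → u k l = 0)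
    (ubar : (k : Fin K) → Fin Nmax → (Fin N → ℝ))
    (hubar : ∀ k l, ubar k l = (C k).mulVec (u k l))
    (Θ : Fin Nmax → Matrix (Fin N) (Fin K) ℝ)
    (hΘ : ∀ l i k, Θ l i k = ubar k l i) :
    ∀ x : Fin N → ℝ, x = ∑ l : Fin Nmax, (Θ l).mulVec ((Θ l)ᵀ.mulVec x) := by
  intro x
  have key : ∀ k (a b : Fin (Nk k)), ∑ l, u k l a * u k l b = if a = b then 1 else 0 := by
    intro k a b
    have hle : Nk k ≤ Nmax := by
      rw [hNmax]; exact Finset.le_sup (Finset.mem_univ k)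
    let W : Matrix (Fin (Nk k)) (Fin (Nk k)) ℝ := Matrix.of fun l a => u k (Fin.castLE hle l) a
    have h1 : W * Wᵀ = 1 := by
      ext l l'
      have := horth k (Fin.castLE hle l) (Fin.castLE hle l') l.2 l'.2
      rw [Matrix.one_apply, Matrix.mul_apply]
      simpa [dotProduct, W] using this
    have h2 : Wᵀ * W = 1 := mul_eq_one_comm.mp h1
    have h3 := congrFun (congrFun h2 a) b
    rw [Matrix.one_apply, Matrix.mul_apply] at h3
    rw [← h3]
    symm
    apply Fintype.sum_of_injective (Fin.castLE hle) (Fin.castLE_injective hle)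
    · intro l hl
      have : Nk k ≤ (l : ℕ) := by
        by_contra hlt
        push Not at hlt
        exact hl ⟨⟨l, hlt⟩, rfl⟩
      simp [hpad k l this]
    · intro l
      rfl
  have hself : ∀ k l a, ubar k l (Γ k a) = u k l a := by
    intro k l a
    rw [hubar]
    simp [Matrix.mulVec, dotProduct, hC, (hinj k).eq_iff]
  have hother : ∀ k k' l a, k' ≠ k → ubar k' l (Γ k a) = 0 := by
    intro k k' l a hk
    rw [hubar]
    simp only [Matrix.mulVec, dotProduct, hC]
    apply Finset.sum_eq_zero
    intro b _
    rw [if_neg, zero_mul]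
    intro h
    have := (hpart (Γ k a)).unique (y₁ := ⟨k', b⟩) (y₂ := ⟨k, a⟩) h rfl
    exact hk (congrArg Sigma.fst this)
  have hpool : ∀ k l, ∑ j, ubar k l j * x j = ∑ b, u k l b * x (Γ k b) := by
    intro k l
    simp only [hubar, Matrix.mulVec, dotProduct, hC, Finset.sum_mul]
    rw [Finset.sum_comm]
    simp
  funext i
  obtain ⟨⟨k, a⟩, rfl, -⟩ := hpart i
  simp only [Finset.sum_apply, Matrix.mulVec, dotProduct, Matrix.transpose_apply, hΘ, hpool]
  have : ∀ l, ∑ k', ubar k' l (Γ k a) * ∑ b, u k' l b * x (Γ k' b)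
      = ∑ b, u k l a * u k l b * x (Γ k b) := by
    intro l
    rw [Finset.sum_eq_single k]
    · simp only [hself, Finset.mul_sum, mul_assoc]
    · intro k' _ hk
      rw [hother k k' l a hk, zero_mul]
    · simp
  simp only [this]
  rw [Finset.sum_comm]
  simp only [← Finset.sum_mul, key]
  simp
end

section
/- Fix a partition of {1,…,N} into K nonempty blocks with sampling operators C^(k) ∈ ℝ^{N×N_k}, orthonormal bases u_1^(k), …, u_{N_k}^(k) of ℝ^{N_k} padded by zeros up to N_max = max_k N_k, and pooling operators Θ_l ∈ ℝ^{N×K}. Then for every graph signal x ∈ ℝ^N, the ℓ₂-norm is preserved by pooling: ‖x‖₂² = Σ_{l=1}^{N_max} ‖Θ_lᵀ x‖₂², i.e. the squared norm of x equals the sum of the squared norms of the pooled signals x_l = Θ_lᵀ x. -/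
open Matrix BigOperators

theorem parseval_aux {n m : ℕ} (h : n ≤ m) (v : Fin m → Fin n → ℝ)
    (horth : ∀ l l' : Fin m, (l : ℕ) < n → (l' : ℕ) < n →
      v l ⬝ᵥ v l' = if l = l' then 1 else 0)
    (hpad : ∀ l : Fin m, n ≤ (l : ℕ) → v l = 0) (y : Fin n → ℝ) :
    ∑ l, (v l ⬝ᵥ y) ^ 2 = ∑ j, y j ^ 2 := by
  let U : Matrix (Fin n) (Fin n) ℝ := Matrix.of fun a j => v (Fin.castLE h a) j
  have hU : U * Uᵀ = 1 := by
    ext a b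
    have := horth (Fin.castLE h a) (Fin.castLE h b) a.2 b.2
    rw [Matrix.one_apply]
    simp only [Fin.castLE_inj] at this
    exact this
  have hU' : Uᵀ * U = 1 := mul_eq_one_comm.mp hU
  have h1 : (U *ᵥ y) ⬝ᵥ (U *ᵥ y) = y ⬝ᵥ y := by
    rw [Matrix.dotProduct_mulVec, ← Matrix.mulVec_transpose, Matrix.mulVec_mulVec, hU',
      Matrix.one_mulVec]
  have h2 : ∑ a : Fin n, (v (Fin.castLE h a) ⬝ᵥ y) ^ 2 = ∑ l, (v l ⬝ᵥ y) ^ 2 := by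
    refine Fintype.sum_of_injective (Fin.castLE h) (Fin.castLE_injective h) _ _ ?_ ?_
    · intro l hl
      rw [hpad l, zero_dotProduct]
      · norm_num
      · by_contra hlt
        exact hl ⟨⟨l, by omega⟩, rfl⟩
    · intro a
      rfl
  rw [← h2]
  simp only [pow_two]
  exact h1

/-- (Energy preserving) For a partition with sampling operators
`C^(k)`, padded orthonormal bases and pooling operators `Θ_l`, the squared ℓ₂-norm
of any signal `x` equals the sum of the squared ℓ₂-norms of the pooled signals
`x_l = Θ_lᵀ x`:  `‖x‖₂² = Σ_{l=1}^{N_max} ‖Θ_lᵀ x‖₂²`. -/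
theorem eigenpooling_energy_preserving {N K : ℕ} (hK : 0 < K)
    (Nk : Fin K → ℕ) (hNk : ∀ k, 0 < Nk k)
    (Γ : (k : Fin K) → Fin (Nk k) → Fin N)
    (hinj : ∀ k, Function.Injective (Γ k))
    (hpart : ∀ i : Fin N, ∃! p : Σ k : Fin K, Fin (Nk k), Γ p.1 p.2 = i)
    (C : (k : Fin K) → Matrix (Fin N) (Fin (Nk k)) ℝ)
    (hC : ∀ k i j, C k i j = if Γ k j = i then 1 else 0)
    (Nmax : ℕ) (hNmax : Nmax = Finset.univ.sup Nk)
    (u : (k : Fin K) → Fin Nmax → (Fin (Nk k) → ℝ))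
    (horth : ∀ k, ∀ l l' : Fin Nmax, (l : ℕ) < Nk k → (l' : ℕ) < Nk k →
      u k l ⬝ᵥ u k l' = if l = l' then 1 else 0)
    (hpad : ∀ k, ∀ l : Fin Nmax, Nk k ≤ (l : ℕ) → u k l = 0)
    (ubar : (k : Fin K) → Fin Nmax → (Fin N → ℝ))
    (hubar : ∀ k l, ubar k l = (C k).mulVec (u k l))
    (Θ : Fin Nmax → Matrix (Fin N) (Fin K) ℝ)
    (hΘ : ∀ l i k, Θ l i k = ubar k l i) :
    ∀ x : Fin N → ℝ,
      ∑ i, x i ^ 2 = ∑ l : Fin Nmax, ∑ k : Fin K, ((Θ l)ᵀ.mulVec x k) ^ 2 := by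
  intro x
  have key : ∀ l k, (Θ l)ᵀ.mulVec x k = u k l ⬝ᵥ (fun j => x (Γ k j)) := by
    intro l k
    simp only [Matrix.mulVec, dotProduct, Matrix.transpose_apply, hΘ, hubar, hC,
      Finset.sum_mul]
    rw [Finset.sum_comm]
    refine Finset.sum_congr rfl fun j _ => ?_
    simp
  have hbij : Function.Bijective (fun p : Σ k : Fin K, Fin (Nk k) => Γ p.1 p.2) :=
    (Function.bijective_iff_existsUnique _).2 hpart
  simp only [key]
  rw [Finset.sum_comm, ← hbij.sum_comp (fun i => x i ^ 2), Fintype.sum_sigma]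
  refine Finset.sum_congr rfl fun k _ => ?_
  have hle : Nk k ≤ Nmax := hNmax ▸ Finset.le_sup (Finset.mem_univ k)
  exact (parseval_aux hle (u k) (horth k) (hpad k) _).symm
end

section
/- Fix a partition of {1,…,N} into K nonempty blocks with sampling operators C^(k) ∈ ℝ^{N×N_k}, orthonormal bases u_1^(k), …, u_{N_k}^(k) of ℝ^{N_k} padded by zeros up to N_max = max_k N_k, and pooling operators Θ_l ∈ ℝ^{N×K}. Let x ∈ ℝ^N be nonzero, let x_l = Θ_lᵀ x be the pooled signals, and for 1 ≤ H ≤ N_max let x' = Σ_{l=1}^{H} Θ_l x_l be the signal reconstructed using only the first H pooling operators. Then the fraction of energy preserved satisfies ‖x'‖₂² / ‖x‖₂² = (Σ_{l=1}^{H} ‖x_l‖₂²) / (Σ_{l=1}^{N_max} ‖x_l‖₂²). -/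
open Matrix BigOperators

theorem blockA {n M : ℕ} (u : Fin M → Fin n → ℝ) (y : Fin n → ℝ)
    (horth : ∀ l l' : Fin M, (l : ℕ) < n → (l' : ℕ) < n →
      u l ⬝ᵥ u l' = if l = l' then 1 else 0)
    (hpad : ∀ l : Fin M, n ≤ (l : ℕ) → u l = 0) (S : Finset (Fin M)) :
    ∑ j, (∑ l ∈ S, (u l ⬝ᵥ y) * u l j) ^ 2 = ∑ l ∈ S, (u l ⬝ᵥ y) ^ 2 := by
  have h1 : ∀ l l', (u l ⬝ᵥ y) * (u l' ⬝ᵥ y) * (u l ⬝ᵥ u l')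
      = if l = l' then (u l ⬝ᵥ y) ^ 2 else 0 := by
    intro l l'
    by_cases hl : (l : ℕ) < n
    · by_cases hl' : (l' : ℕ) < n
      · rw [horth l l' hl hl']
        split_ifs with h
        · subst h; ring
        · ring
      · have : l ≠ l' := by rintro rfl; exact hl' hl
        simp [hpad l' (not_lt.mp hl'), this]
    · simp [hpad l (not_lt.mp hl)]
  calc ∑ j, (∑ l ∈ S, (u l ⬝ᵥ y) * u l j) ^ 2
      = ∑ j, ∑ l ∈ S, ∑ l' ∈ S, (u l ⬝ᵥ y) * (u l' ⬝ᵥ y) * (u l j * u l' j) := by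
        refine Finset.sum_congr rfl fun j _ => ?_
        rw [sq, Finset.sum_mul_sum]
        refine Finset.sum_congr rfl fun l _ => Finset.sum_congr rfl fun l' _ => ?_
        ring
    _ = ∑ l ∈ S, ∑ l' ∈ S, (u l ⬝ᵥ y) * (u l' ⬝ᵥ y) * (u l ⬝ᵥ u l') := by
        rw [Finset.sum_comm]
        refine Finset.sum_congr rfl fun l _ => ?_
        rw [Finset.sum_comm]
        refine Finset.sum_congr rfl fun l' _ => ?_
        rw [← Finset.mul_sum]; rfl
    _ = _ := by
        refine Finset.sum_congr rfl fun l hl => ?_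
        simp only [h1]
        simp [hl]

theorem blockB {n M : ℕ} (hn : n ≤ M) (u : Fin M → Fin n → ℝ) (y : Fin n → ℝ)
    (horth : ∀ l l' : Fin M, (l : ℕ) < n → (l' : ℕ) < n →
      u l ⬝ᵥ u l' = if l = l' then 1 else 0)
    (hpad : ∀ l : Fin M, n ≤ (l : ℕ) → u l = 0) :
    ∑ l, (u l ⬝ᵥ y) ^ 2 = ∑ j, y j ^ 2 := by
  let U : Matrix (Fin n) (Fin n) ℝ := Matrix.of fun l j => u (Fin.castLE hn l) j
  have hU : U * Uᵀ = 1 := by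
    ext l l'
    have := horth (Fin.castLE hn l) (Fin.castLE hn l') l.2 l'.2
    rw [Matrix.one_apply]
    simp only [(Fin.castLE_injective hn).eq_iff] at this
    exact this
  have hU' : Uᵀ * U = 1 := mul_eq_one_comm.mp hU
  have h2 : ∑ l : Fin n, (u (Fin.castLE hn l) ⬝ᵥ y) ^ 2 = ∑ l, (u l ⬝ᵥ y) ^ 2 := by
    refine Fintype.sum_of_injective (Fin.castLE hn) (Fin.castLE_injective hn) _ _ ?_ ?_
    · intro l hl
      have : n ≤ (l : ℕ) := by
        by_contra h
        exact hl ⟨⟨l, not_le.mp h⟩, rfl⟩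
      simp [hpad l this]
    · intro l; rfl
  rw [← h2]
  have h3 : (U *ᵥ y) ⬝ᵥ (U *ᵥ y) = y ⬝ᵥ y := by
    rw [Matrix.dotProduct_mulVec, Matrix.vecMul_mulVec, hU', Matrix.vecMul_one]
  simp only [sq]
  exact h3

/-- (Approximate energy preserving) For a partition with sampling
operators `C^(k)`, padded orthonormal bases and pooling operators `Θ_l`, a nonzero
signal `x` with pooled signals `x_l = Θ_lᵀ x`, and the reconstruction
`x' = Σ_{l=1}^{H} Θ_l x_l` using only the first `H` pooling operators, the fraction
of energy preserved satisfies
`‖x'‖₂² / ‖x‖₂² = (Σ_{l=1}^{H} ‖x_l‖₂²) / (Σ_{l=1}^{N_max} ‖x_l‖₂²)`. -/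
theorem eigenpooling_energy_ratio {N K : ℕ} (hK : 0 < K)
    (Nk : Fin K → ℕ) (hNk : ∀ k, 0 < Nk k)
    (Γ : (k : Fin K) → Fin (Nk k) → Fin N)
    (hinj : ∀ k, Function.Injective (Γ k))
    (hpart : ∀ i : Fin N, ∃! p : Σ k : Fin K, Fin (Nk k), Γ p.1 p.2 = i)
    (C : (k : Fin K) → Matrix (Fin N) (Fin (Nk k)) ℝ)
    (hC : ∀ k i j, C k i j = if Γ k j = i then 1 else 0)
    (Nmax : ℕ) (hNmax : Nmax = Finset.univ.sup Nk)
    (u : (k : Fin K) → Fin Nmax → (Fin (Nk k) → ℝ))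
    (horth : ∀ k, ∀ l l' : Fin Nmax, (l : ℕ) < Nk k → (l' : ℕ) < Nk k →
      u k l ⬝ᵥ u k l' = if l = l' then 1 else 0)
    (hpad : ∀ k, ∀ l : Fin Nmax, Nk k ≤ (l : ℕ) → u k l = 0)
    (ubar : (k : Fin K) → Fin Nmax → (Fin N → ℝ))
    (hubar : ∀ k l, ubar k l = (C k).mulVec (u k l))
    (Θ : Fin Nmax → Matrix (Fin N) (Fin K) ℝ)
    (hΘ : ∀ l i k, Θ l i k = ubar k l i) :
    ∀ x : Fin N → ℝ, x ≠ 0 →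
      ∀ (xl : Fin Nmax → (Fin K → ℝ)), (∀ l, xl l = (Θ l)ᵀ.mulVec x) →
      ∀ (H : ℕ), 1 ≤ H → H ≤ Nmax →
      ∀ x' : Fin N → ℝ,
        x' = ∑ l ∈ Finset.univ.filter (fun l : Fin Nmax => (l : ℕ) < H),
          (Θ l).mulVec (xl l) →
        (∑ i, x' i ^ 2) / (∑ i, x i ^ 2)
          = (∑ l ∈ Finset.univ.filter (fun l : Fin Nmax => (l : ℕ) < H),
              ∑ k : Fin K, xl l k ^ 2)
            / (∑ l : Fin Nmax, ∑ k : Fin K, xl l k ^ 2) := by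
  intro x hx xl hxl H hH1 hH x' hx'
  have hbij : Function.Bijective (fun p : Σ k : Fin K, Fin (Nk k) => Γ p.1 p.2) := by
    constructor
    · intro p q hpq
      exact (hpart (Γ q.1 q.2)).unique hpq rfl
    · intro i
      exact (hpart i).exists
  have hsum : ∀ f : Fin N → ℝ, ∑ i, f i = ∑ k, ∑ j, f (Γ k j) := by
    intro f
    rw [← hbij.sum_comp f, Fintype.sum_sigma]
  have hub : ∀ k l k' j', ubar k l (Γ k' j') = ∑ j, if Γ k j = Γ k' j' then u k l j else 0 := by
    intro k l k' j'
    rw [hubar]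
    simp [Matrix.mulVec, dotProduct, hC]
  have hub1 : ∀ k l j, ubar k l (Γ k j) = u k l j := by
    intro k l j
    rw [hub]
    simp [(hinj k).eq_iff]
  have hub2 : ∀ k l k' j', k ≠ k' → ubar k l (Γ k' j') = 0 := by
    intro k l k' j' h
    rw [hub]
    refine Finset.sum_eq_zero fun j _ => if_neg fun hh => h ?_
    have := @hbij.1 ⟨k, j⟩ ⟨k', j'⟩ hh
    exact congrArg Sigma.fst this
  have hc : ∀ l k, xl l k = u k l ⬝ᵥ (fun j => x (Γ k j)) := by
    intro l k
    rw [hxl]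
    simp only [Matrix.mulVec, dotProduct, Matrix.transpose_apply, hΘ]
    rw [hsum, Finset.sum_eq_single k]
    · simp [hub1]
    · intro k' _ hk'
      simp [hub2 k l k' _ hk'.symm]
    · simp
  have hx'2 : ∀ k j, x' (Γ k j) = ∑ l ∈ Finset.univ.filter (fun l : Fin Nmax => (l : ℕ) < H),
      (u k l ⬝ᵥ (fun j => x (Γ k j))) * u k l j := by
    intro k j
    rw [hx', Finset.sum_apply]
    refine Finset.sum_congr rfl fun l _ => ?_
    simp only [Matrix.mulVec, hΘ]
    rw [dotProduct, Finset.sum_eq_single k]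
    · rw [hub1, hc, mul_comm]
    · intro k' _ hk'
      rw [hub2 k' l k j hk', zero_mul]
    · simp
  have hle : ∀ k, Nk k ≤ Nmax := fun k => hNmax ▸ Finset.le_sup (Finset.mem_univ k)
  congr 1
  · rw [hsum, Finset.sum_comm]
    refine Finset.sum_congr rfl fun k _ => ?_
    simp only [hx'2, hc]
    exact blockA (u k) _ (horth k) (hpad k) _
  · rw [hsum, Finset.sum_comm]
    refine Finset.sum_congr rfl fun k _ => ?_
    simp only [hc]
    exact (blockB (hle k) (u k) _ (horth k) (hpad k)).symm
end
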